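/- Let u be a positive singular solution of (-Δ)³u = c_n·u^{(n+6)/(n-6)} on ℝⁿ\{0}. Then u is superharmonic away from the origin in the classical sense: -Δu(x) ≥ 0 for every x ∈ ℝⁿ\{0}. -/

import Mathlib

noncomputable section

open Real

/-- The Euclidean Laplacian: the sum of the second partial derivatives. -/
def laplacian {n : ℕ} (u : EuclideanSpace ℝ (Fin n) → ℝ) (x : EuclideanSpace ℝ (Fin n)) : ℝ :=
  ∑ i : Fin n, iteratedFDeriv ℝ 2 u x ![EuclideanSpace.single i 1, EuclideanSpace.single i 1]

def cN (n : ℕ) : ℝ := (n : ℝ) * ((n : ℝ) - 6) * ((n : ℝ) ^ 4 - 20 * (n : ℝ) ^ 2 + 64) / 64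

open Filter Topology MeasureTheory

section Abstract

variable {E F : Type*} [NormedAddCommGroup E] [NormedSpace ℝ E] [NormedAddCommGroup F]
  [NormedSpace ℝ F]

lemma HasFDerivAt.comp_add_smul {f : E → F} {f' : E →L[ℝ] F} {a y : E} {c : ℝ}
    (h : HasFDerivAt f f' (a + c • y)) : HasFDerivAt (fun y => f (a + c • y)) (c • f') y := by
  have h := h.comp y (((hasFDerivAt_id y).const_smul c).const_add a)
  rw [ContinuousLinearMap.comp_smul, ContinuousLinearMap.comp_id] at h
  exact h

/-- The trace of a bilinear form along a finite family of vectors, as a continuous linear map. -/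
def traceCLM {ι : Type*} [Fintype ι] (e : ι → E) : (E →L[ℝ] E →L[ℝ] ℝ) →L[ℝ] ℝ :=
  ∑ i, (ContinuousLinearMap.apply ℝ ℝ (e i)).comp
    (ContinuousLinearMap.apply ℝ (E →L[ℝ] ℝ) (e i))

lemma traceCLM_apply {ι : Type*} [Fintype ι] (e : ι → E) (B : E →L[ℝ] E →L[ℝ] ℝ) :
    traceCLM e B = ∑ i, B (e i) (e i) := by
  simp [traceCLM]

lemma ContinuousLinearMap.exists_norm_iteratedFDeriv_comp_left_le (L : F →L[ℝ] ℝ) :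
    ∃ C : ℝ, 0 ≤ C ∧ ∀ (f : E → F) (x : E) (k : ℕ), ContDiffAt ℝ k f x →
      ‖iteratedFDeriv ℝ k (L ∘ f) x‖ ≤ C * ‖iteratedFDeriv ℝ k f x‖ :=
  ⟨‖L‖, norm_nonneg _, fun _ _ _ hf => L.norm_iteratedFDeriv_comp_left hf le_rfl⟩

lemma exists_norm_iteratedFDeriv_trace_le {ι : Type*} [Fintype ι] (e : ι → E) :
    ∃ C : ℝ, 0 ≤ C ∧ ∀ (f : E → ℝ) (x : E) (k : ℕ), ContDiffAt ℝ (k + 2 : ℕ) f x →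
      ‖iteratedFDeriv ℝ k (fun y => ∑ i, fderiv ℝ (fderiv ℝ f) y (e i) (e i)) x‖ ≤
        C * ‖iteratedFDeriv ℝ (k + 2) f x‖ := by
  obtain ⟨C, hC, h⟩ := ContinuousLinearMap.exists_norm_iteratedFDeriv_comp_left_le (E := E)
    (F := E →L[ℝ] E →L[ℝ] ℝ) (traceCLM e)
  refine ⟨C, hC, fun f x k hf => ?_⟩
  have hf' : ContDiffAt ℝ k (fderiv ℝ (fderiv ℝ f)) x :=
    (hf.fderiv_right (m := (k + 1 : ℕ)) (by norm_cast)).fderiv_right (by norm_cast)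
  have he : (fun y => ∑ i, fderiv ℝ (fderiv ℝ f) y (e i) (e i)) =
      traceCLM e ∘ fderiv ℝ (fderiv ℝ f) := by
    ext y; simp [traceCLM_apply]
  rw [he]
  refine (h _ _ _ hf').trans ?_
  rw [norm_iteratedFDeriv_fderiv, norm_iteratedFDeriv_fderiv]

end Abstract

section Laplacian

variable {n : ℕ} {f g : EuclideanSpace ℝ (Fin n) → ℝ} {x : EuclideanSpace ℝ (Fin n)}

lemma laplacian_eq_sum_fderiv_fderiv (f : EuclideanSpace ℝ (Fin n) → ℝ)
    (x : EuclideanSpace ℝ (Fin n)) :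
    laplacian f x = ∑ i : Fin n, fderiv ℝ (fderiv ℝ f) x (EuclideanSpace.single i 1)
      (EuclideanSpace.single i 1) := by
  simp [laplacian, iteratedFDeriv_two_apply]

lemma laplacian_eq_sum (hf : ContDiffAt ℝ 2 f x) :
    laplacian f x = ∑ i : Fin n, fderiv ℝ (fun y => fderiv ℝ f y (EuclideanSpace.single i 1)) x
      (EuclideanSpace.single i 1) := by
  rw [laplacian_eq_sum_fderiv_fderiv]
  refine Finset.sum_congr rfl fun i _ => ?_
  have h : DifferentiableAt ℝ (fderiv ℝ f) x :=
    (hf.fderiv_right (m := 1) (by norm_num)).differentiableAt (by norm_num)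
  rw [fderiv_clm_apply h (differentiableAt_const _)]
  simp

lemma contDiffAt_laplacian {k : ℕ} (hf : ContDiffAt ℝ (k + 2 : ℕ) f x) :
    ContDiffAt ℝ k (laplacian f) x := by
  have h : ContDiffAt ℝ k (fderiv ℝ (fderiv ℝ f)) x :=
    (hf.fderiv_right (m := (k + 1 : ℕ)) (by norm_cast)).fderiv_right (by norm_cast)
  have : laplacian f = fun x => ∑ i : Fin n,
      fderiv ℝ (fderiv ℝ f) x (EuclideanSpace.single i 1) (EuclideanSpace.single i 1) :=
    funext fun x => laplacian_eq_sum_fderiv_fderiv f x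
  rw [this]
  fun_prop

lemma Filter.EventuallyEq.laplacian (h : f =ᶠ[𝓝 x] g) : laplacian f =ᶠ[𝓝 x] laplacian g := by
  filter_upwards [h.fderiv (𝕜 := ℝ) |>.fderiv (𝕜 := ℝ)] with y hy
  rw [laplacian_eq_sum_fderiv_fderiv, laplacian_eq_sum_fderiv_fderiv, hy]

variable (n) in
lemma exists_abs_laplacian_laplacian_laplacian_le :
    ∃ C : ℝ, 0 ≤ C ∧ ∀ (f : EuclideanSpace ℝ (Fin n) → ℝ) (x : EuclideanSpace ℝ (Fin n)),
      ContDiffAt ℝ 6 f x →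
        |laplacian (laplacian (laplacian f)) x| ≤ C * ‖iteratedFDeriv ℝ 6 f x‖ := by
  obtain ⟨C, hC, h⟩ := exists_norm_iteratedFDeriv_trace_le
    (fun i : Fin n => (EuclideanSpace.single i 1 : EuclideanSpace ℝ (Fin n)))
  have hl : ∀ (f : EuclideanSpace ℝ (Fin n) → ℝ) (x : EuclideanSpace ℝ (Fin n)) (k : ℕ),
      ContDiffAt ℝ (k + 2 : ℕ) f x →
      ‖iteratedFDeriv ℝ k (laplacian f) x‖ ≤ C * ‖iteratedFDeriv ℝ (k + 2) f x‖ := by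
    intro f x k hf
    rw [funext (laplacian_eq_sum_fderiv_fderiv f)]
    exact h f x k hf
  refine ⟨C ^ 3, by positivity, fun f x hf => ?_⟩
  have h1 : ContDiffAt ℝ (4 : ℕ) (laplacian f) x := contDiffAt_laplacian hf
  have h2 : ContDiffAt ℝ (2 : ℕ) (laplacian (laplacian f)) x := contDiffAt_laplacian h1
  have e1 := hl f x 4 hf
  have e2 := hl _ x 2 h1
  have e3 := hl _ x 0 h2
  rw [norm_iteratedFDeriv_zero, Real.norm_eq_abs] at e3
  calc _ ≤ _ := e3
    _ ≤ C * (C * (C * ‖iteratedFDeriv ℝ 6 f x‖)) := by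
        gcongr; exact e2.trans (by gcongr)
    _ = _ := by ring

lemma laplacian_comp_add_smul (a : EuclideanSpace ℝ (Fin n))
    (c : ℝ) (hf : ContDiffAt ℝ 2 f (a + c • x)) :
    laplacian (fun y => f (a + c • y)) x = c ^ 2 * laplacian f (a + c • x) := by
  have hcont : ContinuousAt (fun y => a + c • y) x := by fun_prop
  have h2 : fderiv ℝ (fun y => f (a + c • y)) =ᶠ[𝓝 x] fun y => c • fderiv ℝ f (a + c • y) := by
    filter_upwards [hcont.eventually (hf.eventually (by simp))] with y hy
    exact (hy.differentiableAt (by norm_num)).hasFDerivAt.comp_add_smul.fderiv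
  have h3 : DifferentiableAt ℝ (fderiv ℝ f) (a + c • x) :=
    (hf.fderiv_right (m := 1) (by norm_num)).differentiableAt (by norm_num)
  have h4 := (h3.hasFDerivAt.comp_add_smul).const_smul c
  have h5 := (h2.fderiv_eq (𝕜 := ℝ)).trans h4.fderiv
  rw [laplacian_eq_sum_fderiv_fderiv, laplacian_eq_sum_fderiv_fderiv, h5, Finset.mul_sum]
  refine Finset.sum_congr rfl fun i _ => ?_
  simp; ring

lemma integrable_mul_of_tsupport {p q : EuclideanSpace ℝ (Fin n) → ℝ} (hq : Continuous q)
    (hqc : HasCompactSupport q) (hp : ∀ x ∈ tsupport q, ContinuousAt p x) :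
    Integrable (fun x => p x * q x) := by
  have hs : tsupport (fun x => p x * q x) ⊆ tsupport q := tsupport_mul_subset_right
  refine Continuous.integrable_of_hasCompactSupport ?_ ?_
  · exact continuous_of_tsupport fun x hx => (hp x (hs hx)).mul hq.continuousAt
  · exact HasCompactSupport.mono' hqc ((subset_tsupport _).trans hs)

lemma integral_mul_fderiv_eq_neg_of_compact {a b : EuclideanSpace ℝ (Fin n) → ℝ}
    {v : EuclideanSpace ℝ (Fin n)}
    (ha : ∀ x ∈ tsupport b, ContDiffAt ℝ 1 a x) (hb : ContDiff ℝ 1 b)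
    (hbc : HasCompactSupport b) :
    ∫ x, a x * fderiv ℝ b x v = - ∫ x, fderiv ℝ a x v * b x := by
  have hbv : tsupport (fun x => fderiv ℝ b x v) ⊆ tsupport b :=
    (closure_mono (fun x hx => by
      simp only [Function.mem_support] at hx ⊢
      intro h; apply hx; simp [h])).trans (tsupport_fderiv_subset ℝ (f := b))
  refine integral_mul_fderiv_eq_neg_fderiv_mul_of_integrable ?_ ?_ ?_ ?_ ?_
  · refine integrable_mul_of_tsupport hb.continuous hbc fun x hx => ?_
    exact (((ha x hx).fderiv_right (m := 0) (by norm_num)).continuousAt).clm_apply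
      continuousAt_const
  · exact integrable_mul_of_tsupport
      ((hb.continuous_fderiv (by norm_num)).clm_apply continuous_const)
      (HasCompactSupport.mono' hbc ((subset_tsupport _).trans hbv))
      fun x hx => (ha x (hbv hx)).continuousAt
  · exact integrable_mul_of_tsupport hb.continuous hbc fun x hx => (ha x hx).continuousAt
  · exact fun x hx => (ha x hx).differentiableAt (by norm_num)
  · exact fun x _ => hb.differentiable (by norm_num) x

lemma tsupport_laplacian_subset (f : EuclideanSpace ℝ (Fin n) → ℝ) :
    tsupport (laplacian f) ⊆ tsupport f := by
  refine (closure_mono fun x hx => ?_).trans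
    ((tsupport_fderiv_subset ℝ (f := fderiv ℝ f)).trans (tsupport_fderiv_subset ℝ (f := f)))
  simp only [Function.mem_support] at hx ⊢
  intro h
  apply hx
  simp [laplacian_eq_sum_fderiv_fderiv, h]

lemma contDiff_laplacian {k : ℕ} (hf : ContDiff ℝ (k + 2 : ℕ) f) :
    ContDiff ℝ k (laplacian f) :=
  contDiff_iff_contDiffAt.2 fun _ => contDiffAt_laplacian hf.contDiffAt

lemma HasCompactSupport.laplacian (hf : HasCompactSupport f) :
    HasCompactSupport (laplacian f) :=
  HasCompactSupport.mono' hf ((subset_tsupport _).trans (tsupport_laplacian_subset f))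

lemma integral_laplacian_mul {a b : EuclideanSpace ℝ (Fin n) → ℝ}
    (ha : ∀ x ∈ tsupport b, ContDiffAt ℝ 2 a x) (hb : ContDiff ℝ 2 b)
    (hbc : HasCompactSupport b) :
    ∫ x, laplacian a x * b x = ∫ x, a x * laplacian b x := by
  set e : Fin n → EuclideanSpace ℝ (Fin n) := fun i => EuclideanSpace.single i 1 with he
  have hbi : ∀ i, ContDiff ℝ 1 (fun y => fderiv ℝ b y (e i)) := fun i =>
    (hb.fderiv_right (m := 1) (by norm_num)).clm_apply contDiff_const
  have hbs : ∀ i, tsupport (fun y => fderiv ℝ b y (e i)) ⊆ tsupport b := fun i =>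
    (closure_mono (fun x hx => by
      simp only [Function.mem_support] at hx ⊢
      intro h; apply hx; simp [h])).trans (tsupport_fderiv_subset ℝ (f := b))
  have hbic : ∀ i, HasCompactSupport (fun y => fderiv ℝ b y (e i)) := fun i =>
    HasCompactSupport.mono' hbc ((subset_tsupport _).trans (hbs i))
  have hai : ∀ i, ∀ x ∈ tsupport b, ContDiffAt ℝ 1 (fun y => fderiv ℝ a y (e i)) x :=
    fun i x hx => ((ha x hx).fderiv_right (m := 1) (by norm_num)).clm_apply contDiffAt_const
  have hbii : ∀ i, Continuous (fun y => fderiv ℝ (fun y => fderiv ℝ b y (e i)) y (e i)) :=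
    fun i => ((hbi i).continuous_fderiv (by norm_num)).clm_apply continuous_const
  have hbiis : ∀ i, tsupport (fun y => fderiv ℝ (fun y => fderiv ℝ b y (e i)) y (e i)) ⊆
      tsupport b := fun i =>
    ((closure_mono (fun x hx => by
      simp only [Function.mem_support] at hx ⊢
      intro h; apply hx; simp [h])).trans
        (tsupport_fderiv_subset ℝ (f := fun y => fderiv ℝ b y (e i)))).trans (hbs i)
  have h1 : ∀ x, laplacian a x * b x =
      ∑ i, fderiv ℝ (fun y => fderiv ℝ a y (e i)) x (e i) * b x := by
    intro x
    by_cases hx : x ∈ tsupport b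
    · rw [laplacian_eq_sum (ha x hx), Finset.sum_mul]
    · simp [image_eq_zero_of_notMem_tsupport hx]
  have h2 : ∀ x, a x * laplacian b x =
      ∑ i, a x * fderiv ℝ (fun y => fderiv ℝ b y (e i)) x (e i) := by
    intro x
    rw [laplacian_eq_sum hb.contDiffAt, Finset.mul_sum]
  simp_rw [h1, h2]
  rw [integral_finsetSum, integral_finsetSum]
  · refine Finset.sum_congr rfl fun i _ => ?_
    rw [integral_mul_fderiv_eq_neg_of_compact
        (fun x hx => (ha x (hbs i hx)).of_le (by norm_num)) (hbi i) (hbic i),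
      integral_mul_fderiv_eq_neg_of_compact (hai i) (hb.of_le (by norm_num)) hbc]
    simp
  · intro i _
    exact integrable_mul_of_tsupport (hbii i)
      (HasCompactSupport.mono' hbc ((subset_tsupport _).trans (hbiis i)))
      fun x hx => (ha x (hbiis i hx)).continuousAt
  · intro i _
    exact integrable_mul_of_tsupport hb.continuous hbc fun x hx =>
      (((hai i x hx).fderiv_right (m := 0) (by norm_num)).continuousAt).clm_apply
        continuousAt_const

lemma integral_laplacian_laplacian_laplacian_mul {a b : EuclideanSpace ℝ (Fin n) → ℝ}
    (ha : ∀ x ∈ tsupport b, ContDiffAt ℝ 6 a x) (hb : ContDiff ℝ 6 b)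
    (hbc : HasCompactSupport b) :
    ∫ x, laplacian (laplacian (laplacian a)) x * b x =
      ∫ x, a x * laplacian (laplacian (laplacian b)) x := by
  have ha1 : ∀ x ∈ tsupport b, ContDiffAt ℝ (4 : ℕ) (laplacian a) x := fun x hx =>
    contDiffAt_laplacian (ha x hx)
  have ha2 : ∀ x ∈ tsupport b, ContDiffAt ℝ (2 : ℕ) (laplacian (laplacian a)) x := fun x hx =>
    contDiffAt_laplacian (ha1 x hx)
  have hb1 : ContDiff ℝ (4 : ℕ) (laplacian b) := contDiff_laplacian hb
  have hb2 : ContDiff ℝ (2 : ℕ) (laplacian (laplacian b)) := contDiff_laplacian hb1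
  have hs1 := tsupport_laplacian_subset b
  have hs2 := (tsupport_laplacian_subset (laplacian b)).trans hs1
  rw [integral_laplacian_mul ha2 (hb.of_le (by norm_num)) hbc,
    integral_laplacian_mul (fun x hx => (ha1 x (hs1 hx)).of_le (by norm_num))
      (hb1.of_le (by norm_num)) hbc.laplacian,
    integral_laplacian_mul (fun x hx => (ha x (hs2 hx)).of_le (by norm_num)) hb2
      hbc.laplacian.laplacian]

end Laplacian

section Radial

/-- The Laplacian of `x ↦ g (‖x‖ ^ 2)` on `ℝⁿ` as a function of `s = ‖x‖ ^ 2`. -/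
def radialLaplacian (n : ℕ) (g : ℝ → ℝ) (s : ℝ) : ℝ :=
  4 * s * deriv (deriv g) s + 2 * n * deriv g s

lemma ContDiff.deriv_smooth {g : ℝ → ℝ} (hg : ContDiff ℝ (⊤ : ℕ∞) g) :
    ContDiff ℝ (⊤ : ℕ∞) (deriv g) :=
  (contDiff_infty_iff_deriv.1 hg).2

lemma ContDiff.radialLaplacian {g : ℝ → ℝ} (hg : ContDiff ℝ (⊤ : ℕ∞) g) (n : ℕ) :
    ContDiff ℝ (⊤ : ℕ∞) (radialLaplacian n g) := by
  have h1 := hg.deriv_smooth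
  have h2 := h1.deriv_smooth
  unfold _root_.radialLaplacian
  fun_prop

lemma Filter.EventuallyEq.radialLaplacian {g h : ℝ → ℝ} {s : ℝ} (hgh : g =ᶠ[𝓝 s] h) (n : ℕ) :
    radialLaplacian n g =ᶠ[𝓝 s] radialLaplacian n h := by
  filter_upwards [hgh.deriv, hgh.deriv.deriv] with t h1 h2
  simp [_root_.radialLaplacian, h1, h2]

lemma laplacian_radial {n : ℕ} {g : ℝ → ℝ} (hg : ContDiff ℝ (⊤ : ℕ∞) g) :
    laplacian (fun x : EuclideanSpace ℝ (Fin n) => g (‖x‖ ^ 2)) =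
      fun x => radialLaplacian n g (‖x‖ ^ 2) := by
  have hd : ∀ {g : ℝ → ℝ}, ContDiff ℝ (⊤ : ℕ∞) g → ∀ s, HasDerivAt g (deriv g s) s :=
    fun h s => (h.differentiable (by simp) s).hasDerivAt
  have hr : ∀ {g : ℝ → ℝ}, ContDiff ℝ (⊤ : ℕ∞) g → ∀ x : EuclideanSpace ℝ (Fin n),
      HasFDerivAt (fun x : EuclideanSpace ℝ (Fin n) => g (‖x‖ ^ 2))
        (deriv g (‖x‖ ^ 2) • (2 • (innerSL ℝ x))) x := by
    intro g h x
    exact (hd h _).comp_hasFDerivAt x (hasStrictFDerivAt_norm_sq x).hasFDerivAt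
  ext x
  have hc : ContDiff ℝ (⊤ : ℕ∞) (fun x : EuclideanSpace ℝ (Fin n) => g (‖x‖ ^ 2)) :=
    hg.comp (contDiff_norm_sq ℝ)
  rw [laplacian_eq_sum (hc.contDiffAt.of_le
    (show ((2 : ℕ∞) : WithTop ℕ∞) ≤ _ by exact_mod_cast le_top))]
  have h1 : ∀ i : Fin n, (fun y : EuclideanSpace ℝ (Fin n) =>
      fderiv ℝ (fun x : EuclideanSpace ℝ (Fin n) => g (‖x‖ ^ 2)) y (EuclideanSpace.single i 1)) =
      fun y => deriv g (‖y‖ ^ 2) * (2 * y i) := by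
    intro i
    ext y
    rw [(hr hg y).fderiv]
    simp [EuclideanSpace.inner_single_right]
  have h2 : ∀ i : Fin n, fderiv ℝ (fun y : EuclideanSpace ℝ (Fin n) =>
      deriv g (‖y‖ ^ 2) * (2 * y i)) x (EuclideanSpace.single i 1) =
      4 * deriv (deriv g) (‖x‖ ^ 2) * (x i) ^ 2 + 2 * deriv g (‖x‖ ^ 2) := by
    intro i
    have hp : HasFDerivAt (fun y : EuclideanSpace ℝ (Fin n) => 2 * y i)
        ((2 : ℝ) • (EuclideanSpace.proj i : EuclideanSpace ℝ (Fin n) →L[ℝ] ℝ)) x :=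
      (EuclideanSpace.proj i : EuclideanSpace ℝ (Fin n) →L[ℝ] ℝ).hasFDerivAt.const_mul 2
    have hm : HasFDerivAt (fun y : EuclideanSpace ℝ (Fin n) => deriv g (‖y‖ ^ 2) * (2 * y i)) _ x :=
      (hr hg.deriv_smooth x).mul hp
    rw [hm.fderiv]
    simp [EuclideanSpace.inner_single_right]
    ring
  simp_rw [h1, h2]
  rw [Finset.sum_add_distrib, ← Finset.mul_sum, radialLaplacian, EuclideanSpace.norm_sq_eq]
  simp
  ring

/-- A smooth truncation near `0` of the power `s ↦ s ^ (-a)`. -/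
def cutPower (a s : ℝ) : ℝ := Real.smoothTransition (2 * s - 1) * s ^ (-a)

lemma contDiff_cutPower (a : ℝ) : ContDiff ℝ (⊤ : ℕ∞) (cutPower a) := by
  refine contDiff_iff_contDiffAt.2 fun s => ?_
  rcases lt_or_ge s (1 / 2) with hs | hs
  · have : cutPower a =ᶠ[𝓝 s] fun _ => 0 := by
      filter_upwards [Iio_mem_nhds hs] with t ht
      have ht : t < 1 / 2 := ht
      simp [cutPower, Real.smoothTransition.zero_of_nonpos (show 2 * t - 1 ≤ 0 by linarith)]
    exact contDiffAt_const.congr_of_eventuallyEq this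
  · have h1 : ContDiffAt ℝ (⊤ : ℕ∞) (fun s : ℝ => s ^ (-a)) s :=
      Real.contDiffAt_rpow_const_of_ne (by linarith)
    have h2 : ContDiff ℝ (⊤ : ℕ∞) (fun s : ℝ => Real.smoothTransition (2 * s - 1)) :=
      Real.smoothTransition.contDiff.comp (by fun_prop)
    exact h2.contDiffAt.mul h1

lemma cutPower_eq {a s : ℝ} (hs : 1 ≤ s) : cutPower a s = s ^ (-a) := by
  simp [cutPower, Real.smoothTransition.one_of_one_le (show 1 ≤ 2 * s - 1 by linarith)]

lemma cutPower_nonneg (a s : ℝ) : 0 ≤ cutPower a s := by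
  rcases lt_or_ge s (1 / 2) with hs | hs
  · simp [cutPower, Real.smoothTransition.zero_of_nonpos (show 2 * s - 1 ≤ 0 by linarith)]
  · exact mul_nonneg (Real.smoothTransition.nonneg _) (Real.rpow_nonneg (by linarith) _)

lemma radialLaplacian_rpow (n : ℕ) (c b : ℝ) {s : ℝ} (hs : 0 < s) :
    radialLaplacian n (fun s => c * s ^ b) s = c * (4 * b * (b - 1) + 2 * n * b) * s ^ (b - 1) := by
  have h1 : ∀ (c b : ℝ) {s : ℝ}, 0 < s →
      deriv (fun s : ℝ => c * s ^ b) s = c * b * s ^ (b - 1) := by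
    intro c b s hs
    rw [((Real.hasDerivAt_rpow_const (p := b) (Or.inl hs.ne')).const_mul c).deriv]
    ring
  have h2 : deriv (fun s : ℝ => c * s ^ b) =ᶠ[𝓝 s] fun s => c * b * s ^ (b - 1) := by
    filter_upwards [Ioi_mem_nhds hs] with t ht using h1 c b ht
  rw [radialLaplacian, h2.deriv_eq, h1 _ _ hs, h1 _ _ hs]
  have : s ^ (b - 1) = s * s ^ (b - 1 - 1) := by
    rw [Real.rpow_sub_one hs.ne' (b - 1)]
    field_simp
  rw [this]
  ring

lemma radialLaplacian_cutPower_eventuallyEq (n : ℕ) {s : ℝ} (hs : 1 < s) :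
    radialLaplacian n (cutPower (((n : ℝ) - 4) / 2)) =ᶠ[𝓝 s]
      fun s => (-2 * ((n : ℝ) - 4)) * s ^ (-(((n : ℝ) - 2) / 2)) := by
  have h : cutPower (((n : ℝ) - 4) / 2) =ᶠ[𝓝 s] fun s => 1 * s ^ (-(((n : ℝ) - 4) / 2)) := by
    filter_upwards [Ioi_mem_nhds hs] with t ht
    rw [cutPower_eq (le_of_lt ht), one_mul]
  filter_upwards [h.radialLaplacian n, Ioi_mem_nhds hs] with t h1 ht
  rw [h1, radialLaplacian_rpow n _ _ (zero_lt_one.trans ht)]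
  congr 1 <;> ring_nf

lemma radialLaplacian_radialLaplacian_cutPower (n : ℕ) {s : ℝ} (hs : 1 < s) :
    radialLaplacian n (radialLaplacian n (cutPower (((n : ℝ) - 4) / 2))) s = 0 := by
  rw [((radialLaplacian_cutPower_eventuallyEq n hs).radialLaplacian n).eq_of_nhds,
    radialLaplacian_rpow n _ _ (by linarith)]
  ring_nf

lemma integral_radialLaplacian_radialLaplacian_cutPower_pos {n : ℕ} (hn : 5 ≤ n) :
    0 < ∫ x : EuclideanSpace ℝ (Fin n),
      radialLaplacian n (radialLaplacian n (cutPower (((n : ℝ) - 4) / 2))) (‖x‖ ^ 2) := by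
  set φ := radialLaplacian n (cutPower (((n : ℝ) - 4) / 2)) with hφ
  have hφs : ContDiff ℝ (⊤ : ℕ∞) φ := (contDiff_cutPower _).radialLaplacian n
  have hψs := hφs.radialLaplacian n
  have : Nonempty (Fin n) := ⟨⟨0, by omega⟩⟩
  have hF : ∀ r : ℝ, HasDerivAt (fun r : ℝ => 2 * r ^ n * deriv φ (r ^ 2))
      (r ^ (n - 1) * radialLaplacian n φ (r ^ 2)) r := by
    intro r
    have h1 : HasDerivAt (deriv φ) (deriv (deriv φ) (r ^ 2)) (r ^ 2) :=
      (hφs.deriv_smooth.differentiable (by simp) _).hasDerivAt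
    have h2 : HasDerivAt (fun r : ℝ => deriv φ (r ^ 2)) (deriv (deriv φ) (r ^ 2) * (2 * r)) r := by
      simpa [Function.comp_def] using
        HasDerivAt.comp (h₂ := deriv φ) (h := fun r => r ^ 2) r h1 (hasDerivAt_pow 2 r)
    have h3 := ((hasDerivAt_pow n r).const_mul 2).mul h2
    have h4 : r ^ (n - 1) * radialLaplacian n φ (r ^ 2) = 2 * (n * r ^ (n - 1)) * deriv φ (r ^ 2) +
        2 * r ^ n * (deriv (deriv φ) (r ^ 2) * (2 * r)) := by
      have h5 : r ^ n = r ^ (n - 1) * r := by rw [← pow_succ]; congr 1; omega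
      rw [h5, radialLaplacian]
      ring
    rw [h4]
    exact h3
  have hint : ∫ r in Set.Ioi (0 : ℝ), r ^ (n - 1) * radialLaplacian n φ (r ^ 2) =
      2 * 2 ^ n * deriv φ (2 ^ 2) := by
    have h0 : ∫ r in Set.Ioi (0 : ℝ), r ^ (n - 1) * radialLaplacian n φ (r ^ 2) =
        ∫ r in Set.Ioc (0 : ℝ) 2, r ^ (n - 1) * radialLaplacian n φ (r ^ 2) := by
      refine (setIntegral_eq_of_subset_of_forall_sdiff_eq_zero measurableSet_Ioi
        Set.Ioc_subset_Ioi_self fun r hr => ?_)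
      have h2 : 2 < r := by
        by_contra h
        exact hr.2 ⟨hr.1, not_lt.1 h⟩
      rw [hφ, radialLaplacian_radialLaplacian_cutPower n (by nlinarith), mul_zero]
    rw [h0, ← intervalIntegral.integral_of_le (by norm_num),
      intervalIntegral.integral_eq_sub_of_hasDerivAt (fun r _ => hF r)]
    · simp [show n ≠ 0 by omega]
    · have := hψs.continuous
      exact (by fun_prop : Continuous fun r : ℝ =>
        r ^ (n - 1) * radialLaplacian n φ (r ^ 2)).intervalIntegrable _ _
  have hd : 0 < deriv φ (2 ^ 2) := by
    rw [(radialLaplacian_cutPower_eventuallyEq n (s := 2 ^ 2) (by norm_num)).deriv_eq,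
      ((Real.hasDerivAt_rpow_const (Or.inl (by norm_num))).const_mul _).deriv]
    have hn' : (5 : ℝ) ≤ n := by exact_mod_cast hn
    have : (0 : ℝ) < (2 ^ 2 : ℝ) ^ (-(((n : ℝ) - 2) / 2) - 1) := by positivity
    have h3 : (0 : ℝ) < 2 * ((n : ℝ) - 4) * (((n : ℝ) - 2) / 2) := by
      apply mul_pos <;> linarith
    nlinarith [mul_pos h3 this]
  rw [integral_fun_norm_addHaar volume (fun r => radialLaplacian n φ (r ^ 2))]
  simp only [finrank_euclideanSpace, Fintype.card_fin, smul_eq_mul, nsmul_eq_mul]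
  rw [hint]
  have hball : 0 < volume.real (Metric.ball (0 : EuclideanSpace ℝ (Fin n)) 1) :=
    ENNReal.toReal_pos (Metric.measure_ball_pos _ _ one_pos).ne' measure_ball_lt_top.ne
  have : (0 : ℝ) < n := by exact_mod_cast (by omega : 0 < n)
  positivity

end Radial

section Cutoff

variable {E : Type*} [NormedAddCommGroup E] [NormedSpace ℝ E]

lemma exists_norm_iteratedFDeriv_pow_le {ζ : E → ℝ} {N : ℕ} {B : ℝ}
    (hζ : ContDiff ℝ (⊤ : ℕ∞) ζ) (h0 : ∀ x, 0 ≤ ζ x) (h1 : ∀ x, ζ x ≤ 1)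
    (hB : ∀ i ≤ N, ∀ x, ‖iteratedFDeriv ℝ i ζ x‖ ≤ B) (q : ℕ) :
    ∃ C : ℝ, 0 ≤ C ∧ ∀ i ≤ N, ∀ x,
      ‖iteratedFDeriv ℝ i (fun x => ζ x ^ q) x‖ ≤ C * ζ x ^ (q - i) := by
  have hB0 : 0 ≤ B := (norm_nonneg _).trans (hB 0 (Nat.zero_le _) 0)
  induction q with
  | zero =>
    refine ⟨1, zero_le_one, fun i _ x => ?_⟩
    rcases Nat.eq_zero_or_pos i with rfl | hi
    · simp [norm_iteratedFDeriv_zero]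
    · simp [iteratedFDeriv_const_of_ne hi.ne']
  | succ q ih =>
    obtain ⟨C, hC, h⟩ := ih
    refine ⟨C + 2 ^ N * (B * C), by positivity, fun i hi x => ?_⟩
    have hf : (fun x => ζ x ^ (q + 1)) = fun x => ζ x * ζ x ^ q := by ext x; ring
    rw [hf]
    have hle := norm_iteratedFDeriv_mul_le (n := i) hζ (hζ.pow q) x
      (by exact_mod_cast le_top)
    refine hle.trans ?_
    rw [Finset.sum_range_succ']
    have hz : (i.choose 0 : ℝ) * ‖iteratedFDeriv ℝ 0 ζ x‖ *
        ‖iteratedFDeriv ℝ (i - 0) (fun x => ζ x ^ q) x‖ ≤ C * ζ x ^ (q + 1 - i) := by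
      rw [norm_iteratedFDeriv_zero, Real.norm_of_nonneg (h0 x), Nat.choose_zero_right,
        Nat.cast_one, one_mul, Nat.sub_zero]
      calc ζ x * ‖iteratedFDeriv ℝ i (fun x => ζ x ^ q) x‖ ≤ ζ x * (C * ζ x ^ (q - i)) :=
            mul_le_mul_of_nonneg_left (h i hi x) (h0 x)
        _ = C * ζ x ^ (q - i + 1) := by ring
        _ ≤ C * ζ x ^ (q + 1 - i) := mul_le_mul_of_nonneg_left
            (pow_le_pow_of_le_one (h0 x) (h1 x) (by omega)) hC
    have hs : ∑ k ∈ Finset.range i, (i.choose (k + 1) : ℝ) * ‖iteratedFDeriv ℝ (k + 1) ζ x‖ *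
        ‖iteratedFDeriv ℝ (i - (k + 1)) (fun x => ζ x ^ q) x‖ ≤
        2 ^ N * (B * C) * ζ x ^ (q + 1 - i) := by
      calc _ ≤ ∑ k ∈ Finset.range i, (i.choose (k + 1) : ℝ) * (B * C * ζ x ^ (q + 1 - i)) := by
            refine Finset.sum_le_sum fun k hk => ?_
            have hk := Finset.mem_range.1 hk
            rw [mul_assoc, mul_assoc B C]
            refine mul_le_mul_of_nonneg_left ?_ (by positivity)
            refine mul_le_mul (hB _ (by omega) x) ((h _ (by omega) x).trans ?_)
              (norm_nonneg _) hB0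
            exact mul_le_mul_of_nonneg_left
              (pow_le_pow_of_le_one (h0 x) (h1 x) (by omega)) hC
        _ = (∑ k ∈ Finset.range i, (i.choose (k + 1) : ℝ)) * (B * C * ζ x ^ (q + 1 - i)) := by
            rw [Finset.sum_mul]
        _ ≤ 2 ^ N * (B * C * ζ x ^ (q + 1 - i)) := by
            refine mul_le_mul_of_nonneg_right ?_
              (mul_nonneg (mul_nonneg hB0 hC) (pow_nonneg (h0 x) _))
            have h2 := Nat.sum_range_choose i
            rw [Finset.sum_range_succ'] at h2
            have h3 : ∑ k ∈ Finset.range i, i.choose (k + 1) ≤ 2 ^ N :=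
              (by omega : _ ≤ 2 ^ i).trans (Nat.pow_le_pow_right (by norm_num) hi)
            exact_mod_cast h3
        _ = _ := by ring
    linarith

lemma norm_iteratedFDeriv_comp_smul_sub {ζ : E → ℝ} (hζ : ContDiff ℝ (⊤ : ℕ∞) ζ) (i : ℕ) (c : ℝ)
    (z x : E) : ‖iteratedFDeriv ℝ i (fun x => ζ (c • (x - z))) x‖ =
      |c| ^ i * ‖iteratedFDeriv ℝ i ζ (c • (x - z))‖ := by
  have h := iteratedFDeriv_comp_sub (𝕜 := ℝ) (f := fun x => ζ (c • x)) i z x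
  rw [h, iteratedFDeriv_comp_const_smul c (hζ.of_le (by exact_mod_cast le_top))]
  simp [norm_smul]

lemma exists_norm_iteratedFDeriv_cutoff_mul_le {ζ : E → ℝ} {N : ℕ} {B : ℝ}
    (hζ : ContDiff ℝ (⊤ : ℕ∞) ζ) (h0 : ∀ x, 0 ≤ ζ x) (h1 : ∀ x, ζ x ≤ 1)
    (hB : ∀ i ≤ N, ∀ x, ‖iteratedFDeriv ℝ i ζ x‖ ≤ B) (q : ℕ) :
    ∃ C : ℝ, 0 ≤ C ∧ ∀ (c : ℝ) (z x : E) (M : ℝ) (G : E → ℝ), 0 ≤ c → ContDiff ℝ (⊤ : ℕ∞) G →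
      (∀ j ≤ N, ‖iteratedFDeriv ℝ j G x‖ ≤ M * c ^ j) →
      ‖iteratedFDeriv ℝ N (fun x => ζ (c • (x - z)) ^ q * G x) x‖ ≤
        C * M * c ^ N * ζ (c • (x - z)) ^ (q - N) := by
  obtain ⟨C, hC, h⟩ := exists_norm_iteratedFDeriv_pow_le hζ h0 h1 hB q
  refine ⟨2 ^ N * C, by positivity, fun c z x M G hc hG hM => ?_⟩
  have hs : ContDiff ℝ (⊤ : ℕ∞) (fun x => ζ (c • (x - z)) ^ q) :=
    (hζ.comp (by fun_prop)).pow q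
  have hM0 : 0 ≤ M := by
    have := (norm_nonneg _).trans (hM 0 (Nat.zero_le _))
    simpa using this
  refine (norm_iteratedFDeriv_mul_le (n := N) hs hG x (by exact_mod_cast le_top)).trans ?_
  set w := ζ (c • (x - z)) with hw
  have hw0 : 0 ≤ w := h0 _
  calc _ ≤ ∑ i ∈ Finset.range (N + 1), (N.choose i : ℝ) * (C * M * c ^ N * w ^ (q - N)) := by
        refine Finset.sum_le_sum fun i hi => ?_
        have hi : i ≤ N := Nat.lt_succ_iff.1 (Finset.mem_range.1 hi)
        rw [mul_assoc]
        refine mul_le_mul_of_nonneg_left ?_ (by positivity)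
        rw [norm_iteratedFDeriv_comp_smul_sub (ζ := fun x => ζ x ^ q) (hζ.pow q), abs_of_nonneg hc]
        calc _ ≤ c ^ i * (C * w ^ (q - N)) * (M * c ^ (N - i)) := by
              refine mul_le_mul (mul_le_mul_of_nonneg_left ((h i hi _).trans ?_) (by positivity))
                (hM _ (Nat.sub_le _ _)) (norm_nonneg _) (by positivity)
              exact mul_le_mul_of_nonneg_left
                (pow_le_pow_of_le_one hw0 (h1 _) (by omega)) hC
          _ = C * M * (c ^ i * c ^ (N - i)) * w ^ (q - N) := by ring
          _ = C * M * c ^ N * w ^ (q - N) := by rw [← pow_add, Nat.add_sub_cancel' hi]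
    _ = 2 ^ N * C * M * c ^ N * w ^ (q - N) := by
        rw [← Finset.sum_mul]
        have : (∑ i ∈ Finset.range (N + 1), (N.choose i : ℝ)) = 2 ^ N := by
          exact_mod_cast Nat.sum_range_choose N
        rw [this]; ring

lemma exists_forall_norm_iteratedFDeriv_le {ζ : E → ℝ} (hζ : ContDiff ℝ (⊤ : ℕ∞) ζ)
    {K : Set E} (hK : IsCompact K) (N : ℕ) :
    ∃ B : ℝ, ∀ i ≤ N, ∀ x ∈ K, ‖iteratedFDeriv ℝ i ζ x‖ ≤ B := by
  have h : ∀ i : ℕ, ∃ B : ℝ, ∀ x ∈ K, ‖iteratedFDeriv ℝ i ζ x‖ ≤ B := fun i =>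
    hK.exists_bound_of_continuousOn
      (hζ.continuous_iteratedFDeriv (by exact_mod_cast le_top)).continuousOn
  choose B hB using h
  refine ⟨∑ i ∈ Finset.range (N + 1), |B i|, fun i hi x hx => ?_⟩
  exact ((hB i x hx).trans (le_abs_self _)).trans
    (Finset.single_le_sum (f := fun i => |B i|) (fun _ _ => abs_nonneg _)
      (Finset.mem_range.2 (Nat.lt_succ_of_le hi)))

lemma exists_forall_norm_iteratedFDeriv_le_of_hasCompactSupport {ζ : E → ℝ}
    (hc : HasCompactSupport ζ) (hζ : ContDiff ℝ (⊤ : ℕ∞) ζ) (N : ℕ) :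
    ∃ B : ℝ, ∀ i ≤ N, ∀ x, ‖iteratedFDeriv ℝ i ζ x‖ ≤ B := by
  obtain ⟨B, hB⟩ := exists_forall_norm_iteratedFDeriv_le hζ hc N
  refine ⟨|B|, fun i hi x => ?_⟩
  by_cases hx : x ∈ tsupport ζ
  · exact (hB i hi x hx).trans (le_abs_self _)
  · have := mt (fun h => support_iteratedFDeriv_subset (𝕜 := ℝ) i h) hx
    simp [Function.notMem_support.1 this]

lemma exists_forall_norm_iteratedFDeriv_one_sub_le {ζ : E → ℝ}
    (hζ : ContDiff ℝ (⊤ : ℕ∞) ζ) {N : ℕ} {B : ℝ}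
    (hB : ∀ i ≤ N, ∀ x, ‖iteratedFDeriv ℝ i ζ x‖ ≤ B) :
    ∀ i ≤ N, ∀ x, ‖iteratedFDeriv ℝ i (fun x => 1 - ζ x) x‖ ≤ 1 + B := by
  intro i hi x
  have hi' : ContDiffAt ℝ i ζ x := (hζ.of_le (by exact_mod_cast le_top)).contDiffAt
  have h := iteratedFDeriv_sub_apply (𝕜 := ℝ) (i := i) (f := fun _ : E => (1 : ℝ)) (g := ζ)
    (x := x) contDiffAt_const hi'
  have h2 : ‖iteratedFDeriv ℝ i (fun _ : E => (1 : ℝ)) x‖ ≤ 1 := by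
    rcases Nat.eq_zero_or_pos i with rfl | hi
    · simp [norm_iteratedFDeriv_zero]
    · simp [iteratedFDeriv_const_of_ne hi.ne']
  change ‖iteratedFDeriv ℝ i ((fun _ : E => (1 : ℝ)) - ζ) x‖ ≤ 1 + B
  rw [h]
  exact (norm_sub_le _ _).trans (add_le_add h2 (hB i hi x))

end Cutoff

section Kernel

lemma exists_norm_iteratedFDeriv_cutPower_le {E : Type*} [NormedAddCommGroup E]
    [InnerProductSpace ℝ E] [FiniteDimensional ℝ E] (a : ℝ) (N : ℕ) :
    ∃ C : ℝ, 0 ≤ C ∧ ∀ j ≤ N, ∀ x : E, 2 ≤ ‖x‖ →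
      ‖iteratedFDeriv ℝ j (fun x : E => cutPower a (‖x‖ ^ 2)) x‖ ≤
        C * ((‖x‖ / 2) ^ 2) ^ (-a) * ((‖x‖ / 2)⁻¹) ^ j := by
  have hG : ContDiff ℝ (⊤ : ℕ∞) (fun x : E => cutPower a (‖x‖ ^ 2)) :=
    (contDiff_cutPower a).comp (contDiff_norm_sq ℝ)
  obtain ⟨C, hC⟩ := exists_forall_norm_iteratedFDeriv_le hG
    (isCompact_sphere (0 : E) 2) N
  refine ⟨|C|, abs_nonneg _, fun j hj x hx => ?_⟩
  set l := ‖x‖ / 2 with hl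
  have hl1 : 1 ≤ l := by linarith
  have hl0 : 0 < l := by linarith
  set y := l⁻¹ • x with hy
  have hxy : x = l • y := by rw [hy, smul_inv_smul₀ hl0.ne']
  have hny : ‖y‖ = 2 := by
    rw [hy, norm_smul, norm_inv, Real.norm_of_nonneg hl0.le, hl]
    field_simp
  have hev : (fun y : E => cutPower a (‖l • (y - 0)‖ ^ 2)) =ᶠ[𝓝 y]
      (fun y => (l ^ 2) ^ (-a) • cutPower a (‖y‖ ^ 2)) := by
    have : {y : E | 1 < ‖y‖} ∈ 𝓝 y :=
      (isOpen_lt continuous_const continuous_norm).mem_nhds (by simp [hny])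
    filter_upwards [this] with w hw
    have hw : 1 < ‖w‖ := hw
    have h1 : 1 ≤ ‖w‖ ^ 2 := one_le_pow₀ hw.le
    have h2 : ‖l • (w - 0)‖ ^ 2 = l ^ 2 * ‖w‖ ^ 2 := by
      rw [sub_zero, norm_smul, Real.norm_of_nonneg hl0.le, mul_pow]
    rw [h2, cutPower_eq h1, cutPower_eq (one_le_mul_of_one_le_of_one_le (one_le_pow₀ hl1) h1),
      Real.mul_rpow (by positivity) (by positivity), smul_eq_mul]
  have h1 := norm_iteratedFDeriv_comp_smul_sub hG j l 0 y
  have hcd : ContDiffAt ℝ j (fun x : E => cutPower a (‖x‖ ^ 2)) y :=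
    (hG.of_le (by exact_mod_cast le_top)).contDiffAt
  rw [hev.iteratedFDeriv ℝ j |>.eq_of_nhds, iteratedFDeriv_const_smul_apply' hcd, norm_smul,
    Real.norm_of_nonneg (by positivity), sub_zero, ← hxy, abs_of_pos hl0] at h1
  have h2 : ‖iteratedFDeriv ℝ j (fun x : E => cutPower a (‖x‖ ^ 2)) x‖ = (l⁻¹) ^ j *
      ((l ^ 2) ^ (-a) * ‖iteratedFDeriv ℝ j (fun x : E => cutPower a (‖x‖ ^ 2)) y‖) := by
    rw [h1, ← mul_assoc, ← mul_pow, inv_mul_cancel₀ hl0.ne', one_pow, one_mul]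
  rw [h2]
  have h3 := (hC j hj y (by simp [hny])).trans (le_abs_self _)
  calc _ ≤ l⁻¹ ^ j * ((l ^ 2) ^ (-a) * |C|) := by gcongr
    _ = _ := by ring

end Kernel

section TestFunction

variable {n : ℕ}

variable (n) in
/-- The biharmonic kernel `‖x‖ ^ (4 - n)`, smoothed near the origin. -/
def kernel (x : EuclideanSpace ℝ (Fin n)) : ℝ := cutPower (((n : ℝ) - 4) / 2) (‖x‖ ^ 2)

variable (n) in
/-- The bi-Laplacian of `kernel n`, supported in the closed unit ball. -/
def kernelDensity (x : EuclideanSpace ℝ (Fin n)) : ℝ :=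
  radialLaplacian n (radialLaplacian n (cutPower (((n : ℝ) - 4) / 2))) (‖x‖ ^ 2)

lemma contDiff_kernel : ContDiff ℝ (⊤ : ℕ∞) (kernel n) :=
  (contDiff_cutPower _).comp (contDiff_norm_sq ℝ)

lemma contDiff_kernelDensity : ContDiff ℝ (⊤ : ℕ∞) (kernelDensity n) :=
  (((contDiff_cutPower _).radialLaplacian n).radialLaplacian n).comp (contDiff_norm_sq ℝ)

lemma laplacian_laplacian_kernel : laplacian (laplacian (kernel n)) = kernelDensity n := by
  have h1 : laplacian (kernel n) = _ := laplacian_radial (contDiff_cutPower _)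
  rw [h1]
  exact laplacian_radial ((contDiff_cutPower _).radialLaplacian n)

lemma kernelDensity_eq_zero {x : EuclideanSpace ℝ (Fin n)} (hx : 1 < ‖x‖) :
    kernelDensity n x = 0 :=
  radialLaplacian_radialLaplacian_cutPower n (one_lt_pow₀ hx two_ne_zero)

lemma laplacian_kernelDensity_eq_zero {x : EuclideanSpace ℝ (Fin n)} (hx : 1 < ‖x‖) :
    laplacian (kernelDensity n) x = 0 := by
  have h : kernelDensity n =ᶠ[𝓝 x] fun _ => 0 := by
    filter_upwards [(isOpen_lt continuous_const continuous_norm).mem_nhds hx] with y hy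
      using kernelDensity_eq_zero hy
  rw [h.laplacian.eq_of_nhds, laplacian_eq_sum_fderiv_fderiv]
  simp

lemma tsupport_kernelDensity_subset : tsupport (kernelDensity n) ⊆ Metric.closedBall 0 1 :=
  closure_minimal (fun x hx => by
    by_contra h
    exact hx (kernelDensity_eq_zero (by simpa using h))) Metric.isClosed_closedBall

lemma hasCompactSupport_kernelDensity : HasCompactSupport (kernelDensity n) :=
  HasCompactSupport.of_support_subset_isCompact (isCompact_closedBall 0 1)
    ((subset_tsupport _).trans tsupport_kernelDensity_subset)

lemma kernel_nonneg (x : EuclideanSpace ℝ (Fin n)) : 0 ≤ kernel n x := cutPower_nonneg _ _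

lemma le_kernel (hn : 4 ≤ n) {r : ℝ} {x : EuclideanSpace ℝ (Fin n)} (hx : 1 ≤ ‖x‖)
    (hr : ‖x‖ ≤ r) : (r ^ 2) ^ (-(((n : ℝ) - 4) / 2)) ≤ kernel n x := by
  have hn' : (4 : ℝ) ≤ n := by exact_mod_cast hn
  rw [kernel, cutPower_eq (one_le_pow₀ hx)]
  exact Real.rpow_le_rpow_of_nonpos (by positivity) (by gcongr) (by linarith)

/-- Truncation of the biharmonic kernel at infinity and around a point `z`. The errors in its
tri-Laplacian are controlled by powers of the cutoffs. -/
lemma exists_truncated_kernel (hn : 7 ≤ n) {z : EuclideanSpace ℝ (Fin n)} (hz : 3 ≤ ‖z‖) :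
    ∃ C γ₀ : ℝ, 0 ≤ C ∧ 0 < γ₀ ∧ ∀ ε : ℝ, 0 < ε → 3 * ε ≤ 1 → ε * (‖z‖ + 1) < 1 →
      ∃ ψ : EuclideanSpace ℝ (Fin n) → ℝ, ContDiff ℝ 6 ψ ∧ HasCompactSupport ψ ∧
        z ∉ tsupport ψ ∧ (∀ x, 0 ≤ ψ x) ∧ ∀ x,
          laplacian (laplacian (laplacian ψ)) x = laplacian (kernelDensity n) x ∨
          laplacian (kernelDensity n) x = 0 ∧ ∃ θ, 0 ≤ θ ∧ θ ≤ 1 ∧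
            (x ∈ Metric.ball z (3 * ε) ∧ γ₀ * θ ^ (n + 6) ≤ ψ x ∧
              |laplacian (laplacian (laplacian ψ)) x| ≤ γ₀ * (C * ε⁻¹ ^ 6 * θ ^ n) ∨
            x ∈ Metric.ball 0 (2 * ε⁻¹) ∧
              ((2 * ε⁻¹) ^ 2) ^ (-(((n : ℝ) - 4) / 2)) * θ ^ (n + 6) ≤ ψ x ∧
              |laplacian (laplacian (laplacian ψ)) x| ≤
                ((2 * ε⁻¹) ^ 2) ^ (-(((n : ℝ) - 4) / 2)) * (C * ε ^ 6 * θ ^ n)) := by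
  have hn' : (7 : ℝ) ≤ n := by exact_mod_cast hn
  set a : ℝ := ((n : ℝ) - 4) / 2 with ha
  have ha0 : 0 < a := by rw [ha]; linarith
  let b : ContDiffBump (0 : EuclideanSpace ℝ (Fin n)) := ⟨1, 2, one_pos, by norm_num⟩
  have hb : ContDiff ℝ (⊤ : ℕ∞) (b : EuclideanSpace ℝ (Fin n) → ℝ) := b.contDiff
  have hb1 : ContDiff ℝ (⊤ : ℕ∞) (fun x => 1 - b x) := contDiff_const.sub hb
  obtain ⟨B, hB⟩ := exists_forall_norm_iteratedFDeriv_le_of_hasCompactSupport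
    b.hasCompactSupport hb 6
  obtain ⟨C₁, hC₁, hcut₁⟩ := exists_norm_iteratedFDeriv_cutoff_mul_le hb1
    (fun x => sub_nonneg.2 b.le_one) (fun x => sub_le_self 1 b.nonneg)
    (exists_forall_norm_iteratedFDeriv_one_sub_le hb hB) (n + 6)
  obtain ⟨C₂, hC₂, hcut₂⟩ := exists_norm_iteratedFDeriv_cutoff_mul_le hb
    (fun x => b.nonneg) (fun x => b.le_one) hB (n + 6)
  obtain ⟨C₃, hC₃, hker⟩ := exists_norm_iteratedFDeriv_cutPower_le
    (E := EuclideanSpace ℝ (Fin n)) a 6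
  obtain ⟨C₄, hC₄, hlap⟩ := exists_abs_laplacian_laplacian_laplacian_le n
  set γ₀ : ℝ := ((‖z‖ + 1) ^ 2) ^ (-a) with hγ₀
  have hγ₀0 : 0 < γ₀ := by positivity
  refine ⟨C₄ * C₁ * C₃ / γ₀ + C₄ * C₂ * (C₃ * 2 ^ 6 * 16 ^ a), γ₀, by positivity, hγ₀0,
    fun ε hε hε3 hεz => ?_⟩
  set γ : ℝ := ((2 * ε⁻¹) ^ 2) ^ (-a) with hγ
  have hγ0 : 0 < γ := by positivity
  set R : ℝ := ε⁻¹ with hR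
  have hR0 : 0 < R := inv_pos.2 hε
  have hεR : ε * R = 1 := mul_inv_cancel₀ hε.ne'
  have hR3 : 3 ≤ R := by nlinarith
  have hRz : ‖z‖ + 1 < R := by nlinarith
  set α : EuclideanSpace ℝ (Fin n) → ℝ := fun x => (1 - b (R • (x - z))) ^ (n + 6) with hα
  set β : EuclideanSpace ℝ (Fin n) → ℝ := fun x => b (ε • (x - 0)) ^ (n + 6) with hβ
  have hαs : ContDiff ℝ (⊤ : ℕ∞) α :=
    (hb1.comp (by fun_prop : ContDiff ℝ (⊤ : ℕ∞) fun x => R • (x - z))).pow _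
  have hβs : ContDiff ℝ (⊤ : ℕ∞) β :=
    (hb.comp (by fun_prop : ContDiff ℝ (⊤ : ℕ∞)
      fun x : EuclideanSpace ℝ (Fin n) => ε • (x - 0))).pow _
  have hα0 : ∀ x, 0 ≤ α x := fun x => pow_nonneg (sub_nonneg.2 b.le_one) _
  have hβ0 : ∀ x, 0 ≤ β x := fun x => pow_nonneg b.nonneg _
  have hα1 : ∀ x, 2 * ε < ‖x - z‖ → α x = 1 := by
    intro x hx
    have : b (R • (x - z)) = 0 := b.zero_of_le_dist (by
      rw [dist_zero_right, norm_smul, Real.norm_of_nonneg hR0.le]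
      show (2 : ℝ) ≤ _
      nlinarith)
    simp [hα, this]
  have hβ1 : ∀ x : EuclideanSpace ℝ (Fin n), ‖x‖ < R → β x = 1 := by
    intro x hx
    have : b (ε • (x - 0)) = 1 := b.one_of_mem_closedBall (by
      rw [mem_closedBall_zero_iff, norm_smul, Real.norm_of_nonneg hε.le, sub_zero]
      show _ ≤ (1 : ℝ)
      nlinarith)
    change b (ε • (x - 0)) ^ (n + 6) = 1
    rw [this, one_pow]
  have hb2 : ∀ x : EuclideanSpace ℝ (Fin n), 2 * R ≤ ‖x‖ → b (ε • (x - 0)) = 0 := by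
    intro x hx
    exact b.zero_of_le_dist (by
      rw [dist_zero_right, norm_smul, Real.norm_of_nonneg hε.le, sub_zero]
      show (2 : ℝ) ≤ _
      nlinarith)
  have hcontz : Continuous fun x => ‖x - z‖ := by fun_prop
  refine ⟨fun x => α x * (β x * kernel n x), ?_, ?_, ?_, ?_, fun x => ?_⟩
  · exact (hαs.mul (hβs.mul contDiff_kernel)).of_le
      (show ((6 : ℕ∞) : WithTop ℕ∞) ≤ _ by exact_mod_cast le_top)
  · refine HasCompactSupport.of_support_subset_isCompact
      (isCompact_closedBall (0 : EuclideanSpace ℝ (Fin n)) (2 * R)) fun x hx => ?_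
    by_contra h
    refine hx ?_
    have h : 2 * R ≤ ‖x‖ := (not_le.1 (by simpa using h)).le
    have : β x = 0 := by
      change b (ε • (x - 0)) ^ (n + 6) = 0
      rw [hb2 x h, zero_pow (by omega)]
    simp [this]
  · rw [notMem_tsupport_iff_eventuallyEq]
    filter_upwards [Metric.ball_mem_nhds z hε] with x hx
    have hx : ‖x - z‖ < ε := by simpa [dist_eq_norm] using hx
    have : b (R • (x - z)) = 1 := b.one_of_mem_closedBall (by
      rw [mem_closedBall_zero_iff, norm_smul, Real.norm_of_nonneg hR0.le]
      show _ ≤ (1 : ℝ)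
      nlinarith)
    simp [hα, this]
  · exact fun x => mul_nonneg (hα0 x) (mul_nonneg (hβ0 x) (kernel_nonneg x))
  have hGs := contDiff_kernel (n := n)
  have h6 : ∀ {f : EuclideanSpace ℝ (Fin n) → ℝ} {x}, ContDiff ℝ (⊤ : ℕ∞) f →
      ContDiffAt ℝ 6 f x := fun h => (h.of_le
        (show ((6 : ℕ∞) : WithTop ℕ∞) ≤ _ by exact_mod_cast le_top)).contDiffAt
  rcases lt_or_ge ‖x - z‖ (3 * ε) with hxz | hxz
  · have hx1 : ‖z‖ ≤ ‖x‖ + ‖x - z‖ := by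
      rw [norm_sub_rev]; simpa using norm_add_le x (z - x)
    have hx2 : ‖x‖ ≤ ‖x - z‖ + ‖z‖ := by simpa using norm_add_le (x - z) z
    have hloc : (fun x => α x * (β x * kernel n x)) =ᶠ[𝓝 x] fun x => α x * kernel n x := by
      filter_upwards [(isOpen_lt continuous_norm continuous_const).mem_nhds
        (show ‖x‖ < R by linarith)] with y hy
      rw [hβ1 y hy, one_mul]
    refine Or.inr ⟨laplacian_kernelDensity_eq_zero (by linarith), 1 - b (R • (x - z)),
      sub_nonneg.2 b.le_one, sub_le_self 1 b.nonneg, Or.inl ⟨by simpa [dist_eq_norm] using hxz,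
        ?_, ?_⟩⟩
    · change _ ≤ α x * (β x * kernel n x)
      rw [hβ1 x (by linarith), one_mul, mul_comm]
      exact mul_le_mul_of_nonneg_left (le_kernel (by omega) (by linarith) (by linarith)) (hα0 x)
    · rw [hloc.laplacian.laplacian.laplacian.eq_of_nhds]
      refine (hlap _ x (h6 (hαs.mul hGs))).trans ?_
      have hle := hcut₁ R z x C₃ (kernel n) hR0.le hGs fun j hj => by
        refine (hker j hj x (by linarith)).trans ?_
        have hl : 1 ≤ ‖x‖ / 2 := by linarith
        have e1 : ((‖x‖ / 2) ^ 2) ^ (-a) ≤ 1 :=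
          Real.rpow_le_one_of_one_le_of_nonpos (one_le_pow₀ hl) (by linarith)
        have e2 : ((‖x‖ / 2)⁻¹) ^ j ≤ R ^ j := by
          have : (‖x‖ / 2)⁻¹ ≤ 1 := inv_le_one_of_one_le₀ hl
          gcongr
          linarith
        calc _ ≤ C₃ * 1 * R ^ j := by gcongr
          _ = _ := by ring
      set θ := 1 - b (R • (x - z)) with hθ
      have hθ0 : 0 ≤ θ := sub_nonneg.2 b.le_one
      rw [Nat.add_sub_cancel] at hle
      calc _ ≤ C₄ * (C₁ * C₃ * R ^ 6 * θ ^ n) := by gcongr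
        _ = γ₀ * (C₄ * C₁ * C₃ / γ₀ * R ^ 6 * θ ^ n) := by field_simp
        _ ≤ _ := by
          gcongr
          exact le_add_of_nonneg_right (by positivity)
  · have hα1' : ∀ᶠ y in 𝓝 x, α y = 1 := by
      filter_upwards [(isOpen_lt continuous_const hcontz).mem_nhds
        (show 2 * ε < ‖x - z‖ by linarith)] with y hy using hα1 y hy
    rcases lt_or_ge ‖x‖ R with hxR | hxR
    · left
      have hloc : (fun x => α x * (β x * kernel n x)) =ᶠ[𝓝 x] kernel n := by
        filter_upwards [hα1', (isOpen_lt continuous_norm continuous_const).mem_nhds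
          hxR] with y hy1 hy
        rw [hβ1 y hy, hy1, one_mul, one_mul]
      rw [hloc.laplacian.laplacian.laplacian.eq_of_nhds, laplacian_laplacian_kernel]
    · have hloc : (fun x => α x * (β x * kernel n x)) =ᶠ[𝓝 x] fun x => β x * kernel n x := by
        filter_upwards [hα1'] with y hy1
        rw [hy1, one_mul]
      have hbd : |laplacian (laplacian (laplacian (fun x => α x * (β x * kernel n x)))) x| ≤
          γ * ((C₄ * C₁ * C₃ / γ₀ + C₄ * C₂ * (C₃ * 2 ^ 6 * 16 ^ a)) * ε ^ 6 *
            b (ε • (x - 0)) ^ n) := by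
        rw [hloc.laplacian.laplacian.laplacian.eq_of_nhds]
        refine (hlap _ x (h6 (hβs.mul hGs))).trans ?_
        have hle := hcut₂ ε 0 x (C₃ * 2 ^ 6 * ((R / 2) ^ 2) ^ (-a)) (kernel n) hε.le hGs
            fun j hj => by
          refine (hker j hj x (by linarith)).trans ?_
          have e1 : ((‖x‖ / 2) ^ 2) ^ (-a) ≤ ((R / 2) ^ 2) ^ (-a) :=
            Real.rpow_le_rpow_of_nonpos (by positivity) (by gcongr) (by linarith)
          have e2 : ((‖x‖ / 2)⁻¹) ^ j ≤ 2 ^ 6 * ε ^ j := by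
            have h1 : (‖x‖ / 2)⁻¹ ≤ 2 * ε := by
              rw [inv_le_comm₀ (by linarith) (by positivity), mul_inv, ← hR]
              linarith
            have h0 : 0 < (‖x‖ / 2)⁻¹ := inv_pos.2 (by linarith)
            calc ((‖x‖ / 2)⁻¹) ^ j ≤ (2 * ε) ^ j := by gcongr
              _ = 2 ^ j * ε ^ j := mul_pow _ _ _
              _ ≤ _ := by
                gcongr
                norm_num
          calc _ ≤ C₃ * ((R / 2) ^ 2) ^ (-a) * (2 ^ 6 * ε ^ j) := by gcongr
            _ = _ := by ring
        have hRγ : ((R / 2) ^ 2) ^ (-a) = 16 ^ a * γ := by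
          rw [hγ, show (2 * R) ^ 2 = 16 * (R / 2) ^ 2 by ring,
            Real.mul_rpow (by norm_num) (by positivity), ← mul_assoc,
            ← Real.rpow_add (by norm_num)]
          simp
        rw [Nat.add_sub_cancel, hRγ] at hle
        have hθ0 : 0 ≤ b (ε • (x - 0)) := b.nonneg
        calc _ ≤ C₄ * (C₂ * (C₃ * 2 ^ 6 * (16 ^ a * γ)) * ε ^ 6 * b (ε • (x - 0)) ^ n) := by
              gcongr
          _ = γ * (C₄ * C₂ * (C₃ * 2 ^ 6 * 16 ^ a) * ε ^ 6 * b (ε • (x - 0)) ^ n) := by ring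
          _ ≤ _ := by
            gcongr
            exact le_add_of_nonneg_left (by positivity)
      rcases lt_or_ge ‖x‖ (2 * R) with hx2 | hx2
      · refine Or.inr ⟨laplacian_kernelDensity_eq_zero (by linarith), b (ε • (x - 0)),
          b.nonneg, b.le_one, Or.inr ⟨by simpa using hx2, ?_, hbd⟩⟩
        change _ ≤ α x * (β x * kernel n x)
        rw [hα1'.self_of_nhds, one_mul, mul_comm]
        exact mul_le_mul_of_nonneg_left (le_kernel (by omega) (by linarith) hx2.le) (hβ0 x)
      · left
        rw [laplacian_kernelDensity_eq_zero (by linarith)]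
        rw [hb2 x hx2, zero_pow (by omega), mul_zero, mul_zero] at hbd
        exact abs_nonpos_iff.1 hbd

end TestFunction

section Superharmonic

lemma exists_young_cutoff {n : ℕ} (hn : 7 ≤ n) {c : ℝ} (hc : 0 < c) :
    ∃ K : ℝ, 0 ≤ K ∧ ∀ v τ θ : ℝ, 0 ≤ v → 0 ≤ τ → 0 ≤ θ → θ ≤ 1 →
      v * (τ * θ ^ n) ≤ c * v ^ (((n : ℝ) + 6) / ((n : ℝ) - 6)) * θ ^ (n + 6) +
        K * τ ^ (((n : ℝ) + 6) / 12) := by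
  have hn' : (7 : ℝ) ≤ n := by exact_mod_cast hn
  set p : ℝ := ((n : ℝ) + 6) / ((n : ℝ) - 6) with hp
  set q : ℝ := ((n : ℝ) + 6) / 12 with hq
  have h6 : 0 < (n : ℝ) - 6 := by linarith
  have hp0 : 0 < p := div_pos (by linarith) h6
  have hq0 : 0 < q := by positivity
  have hpq : p.HolderConjugate q := by
    rw [Real.holderConjugate_iff]
    refine ⟨(one_lt_div h6).2 (by linarith), ?_⟩
    rw [hp, hq]
    field_simp
    ring
  set s : ℝ := (c * p) ^ p⁻¹ with hs
  have hs0 : 0 < s := by positivity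
  refine ⟨s⁻¹ ^ q / q, by positivity, fun v τ θ hv hτ hθ hθ1 => ?_⟩
  have hθp : (θ ^ (n - 6)) ^ p = θ ^ (n + 6) := by
    rw [← Real.rpow_natCast, ← Real.rpow_mul hθ, ← Real.rpow_natCast, Nat.cast_sub (by omega), hp]
    congr 1
    push_cast
    field_simp
  have hy := Real.young_inequality_of_nonneg (a := s * (v * θ ^ (n - 6))) (b := τ * s⁻¹)
    (by positivity) (by positivity) hpq
  rw [Real.mul_rpow hs0.le (by positivity), Real.mul_rpow hv (by positivity), hθp, hs,
    Real.rpow_inv_rpow (by positivity) hp0.ne', ← hs, Real.mul_rpow hτ (by positivity)] at hy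
  calc v * (τ * θ ^ n) ≤ v * (τ * θ ^ (n - 6)) := by
        gcongr ?_ * (?_ * ?_)
        exact pow_le_pow_of_le_one hθ hθ1 (by omega)
    _ = s * (v * θ ^ (n - 6)) * (τ * s⁻¹) := by field_simp
    _ ≤ _ := hy
    _ = _ := by field_simp

lemma measureReal_ball (n : ℕ) (x : EuclideanSpace ℝ (Fin n)) {r : ℝ} (hr : 0 < r) :
    volume.real (Metric.ball x r) =
      r ^ n * volume.real (Metric.ball (0 : EuclideanSpace ℝ (Fin n)) 1) := by
  rw [Measure.real, Measure.addHaar_ball_of_pos _ _ hr, ENNReal.toReal_mul,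
    ENNReal.toReal_ofReal (by positivity), finrank_euclideanSpace_fin]
  rfl

lemma integral_laplacian_mul_kernelDensity_nonpos {n : ℕ} (hn : 7 ≤ n) {c : ℝ} (hc : 0 < c)
    {z : EuclideanSpace ℝ (Fin n)} (hz : 3 ≤ ‖z‖) {v : EuclideanSpace ℝ (Fin n) → ℝ}
    (hpos : ∀ x, x ≠ z → 0 < v x) (hreg : ∀ x, x ≠ z → ContDiffAt ℝ 6 v x)
    (hpde : ∀ x, x ≠ z → -(laplacian (laplacian (laplacian v)) x) =
      c * v x ^ (((n : ℝ) + 6) / ((n : ℝ) - 6))) :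
    ∫ x, laplacian v x * kernelDensity n x ≤ 0 := by
  have hn' : (7 : ℝ) ≤ n := by exact_mod_cast hn
  obtain ⟨C, γ₀, hC, hγ₀, htest⟩ := exists_truncated_kernel hn hz
  obtain ⟨K, hK, hyoung⟩ := exists_young_cutoff hn hc
  set p : ℝ := ((n : ℝ) + 6) / ((n : ℝ) - 6) with hp
  set q : ℝ := ((n : ℝ) + 6) / 12 with hq
  set a : ℝ := ((n : ℝ) - 4) / 2 with ha
  set ω := volume.real (Metric.ball (0 : EuclideanSpace ℝ (Fin n)) 1) with hω
  have hzρ : z ∉ tsupport (kernelDensity n) := fun h => by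
    have := mem_closedBall_zero_iff.1 (tsupport_kernelDensity_subset h)
    linarith
  have hρ2 : ContDiff ℝ 2 (kernelDensity n) := contDiff_kernelDensity.of_le
    (show ((2 : ℕ∞) : WithTop ℕ∞) ≤ _ by exact_mod_cast le_top)
  have hΔρ : Continuous (laplacian (kernelDensity n)) :=
    (contDiff_laplacian (k := 0) (by exact_mod_cast hρ2)).continuous
  have hbound : ∀ ε : ℝ, 0 < ε → 3 * ε ≤ 1 → ε * (‖z‖ + 1) < 1 →
      ∫ x, laplacian v x * kernelDensity n x ≤
        γ₀ * K * C ^ q * 3 ^ n * ω * ε ^ (((n : ℝ) - 6) / 2) +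
          K * C ^ q * ω * 16 * ε ^ (((n : ℝ) - 2) / 2) := by
    intro ε hε hε3 hεz
    obtain ⟨ψ, hψ, hψc, hzψ, hψ0, hcases⟩ := htest ε hε hε3 hεz
    set γ : ℝ := ((2 * ε⁻¹) ^ 2) ^ (-a) with hγ
    have hγ0 : 0 < γ := by positivity
    have hΔψ : Continuous (laplacian (laplacian (laplacian ψ))) :=
      (contDiff_laplacian (k := 0) (contDiff_laplacian (k := 2) (contDiff_laplacian (k := 4)
        (by exact_mod_cast hψ)))).continuous
    have hψv : ∀ x ∈ tsupport ψ, ContDiffAt ℝ 6 v x := fun x hx =>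
      hreg x fun h => hzψ (h ▸ hx)
    have hρv : ∀ x ∈ tsupport (kernelDensity n), ContDiffAt ℝ 6 v x := fun x hx =>
      hreg x fun h => hzρ (h ▸ hx)
    set e₁ : ℝ := γ₀ * (K * (C * ε⁻¹ ^ 6) ^ q) with he₁
    set e₂ : ℝ := γ * (K * (C * ε ^ 6) ^ q) with he₂
    have he₁0 : 0 ≤ e₁ := by positivity
    have he₂0 : 0 ≤ e₂ := by positivity
    set err : EuclideanSpace ℝ (Fin n) → ℝ := fun x =>
      (Metric.ball z (3 * ε)).indicator (fun _ => e₁) x +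
        (Metric.ball 0 (2 * ε⁻¹)).indicator (fun _ => e₂) x with herr
    have hi₁ : Integrable ((Metric.ball z (3 * ε)).indicator (fun _ => e₁)) :=
      (integrable_indicator_iff Metric.isOpen_ball.measurableSet).2
        (integrableOn_const measure_ball_lt_top.ne)
    have hi₂ : Integrable ((Metric.ball (0 : EuclideanSpace ℝ (Fin n)) (2 * ε⁻¹)).indicator
        (fun _ => e₂)) :=
      (integrable_indicator_iff Metric.isOpen_ball.measurableSet).2
        (integrableOn_const measure_ball_lt_top.ne)
    have hierr : Integrable err := hi₁.add hi₂
    have herr₁ : ∀ x, (Metric.ball z (3 * ε)).indicator (fun _ => e₁) x ≤ err x := fun x =>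
      le_add_of_nonneg_right (Set.indicator_nonneg (fun _ _ => he₂0) x)
    have herr₂ : ∀ x, (Metric.ball 0 (2 * ε⁻¹)).indicator (fun _ => e₂) x ≤ err x := fun x =>
      le_add_of_nonneg_left (Set.indicator_nonneg (fun _ _ => he₁0) x)
    have herr0 : ∀ x, 0 ≤ err x := fun x =>
      (Set.indicator_nonneg (fun _ _ => he₁0) x).trans (herr₁ x)
    have hpt : ∀ x, v x * laplacian (kernelDensity n) x ≤
        v x * laplacian (laplacian (laplacian ψ)) x -
          laplacian (laplacian (laplacian v)) x * ψ x + err x := by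
      intro x
      by_cases hx : x = z
      · have h0 : ψ x = 0 := image_eq_zero_of_notMem_tsupport (hx ▸ hzψ)
        have h1 : laplacian (laplacian (laplacian ψ)) x = 0 :=
          image_eq_zero_of_notMem_tsupport fun h => hzψ (hx ▸ tsupport_laplacian_subset _
            (tsupport_laplacian_subset _ (tsupport_laplacian_subset _ h)))
        rw [laplacian_kernelDensity_eq_zero (by rw [hx]; linarith), h0, h1]
        simpa using herr0 x
      · have hvx := hpos x hx
        rw [sub_eq_add_neg, ← neg_mul, hpde x hx]
        have key : ∀ (g τ θ : ℝ), 0 ≤ g → 0 ≤ τ → 0 ≤ θ → θ ≤ 1 → g * θ ^ (n + 6) ≤ ψ x →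
            |laplacian (laplacian (laplacian ψ)) x| ≤ g * (τ * θ ^ n) →
            0 ≤ v x * laplacian (laplacian (laplacian ψ)) x + c * v x ^ p * ψ x +
              g * (K * τ ^ q) := by
          intro g τ θ hg hτ hθ hθ1 h1 h2
          have h3 := neg_le_of_abs_le h2
          have h4 := mul_le_mul_of_nonneg_left (hyoung (v x) τ θ hvx.le hτ hθ hθ1) hg
          have h5 := mul_le_mul_of_nonneg_left h1 (by positivity : 0 ≤ c * v x ^ p)
          have h6 := mul_le_mul_of_nonneg_left h3 hvx.le
          linarith
        rcases hcases x with h | ⟨h, θ, hθ, hθ1, ⟨hx, h1, h2⟩ | ⟨hx, h1, h2⟩⟩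
        · rw [h]
          have : 0 ≤ c * v x ^ p * ψ x := mul_nonneg (by positivity) (hψ0 x)
          linarith [herr0 x]
        · have h3 := herr₁ x
          rw [Set.indicator_of_mem hx] at h3
          rw [h, mul_zero]
          exact (key _ _ _ hγ₀.le (by positivity) hθ hθ1 h1 h2).trans (by linarith)
        · have h3 := herr₂ x
          rw [Set.indicator_of_mem hx] at h3
          rw [h, mul_zero]
          exact (key _ _ _ hγ0.le (by positivity) hθ hθ1 h1 h2).trans (by linarith)
    have hint₁ : Integrable fun x => v x * laplacian (kernelDensity n) x :=
      integrable_mul_of_tsupport hΔρ hasCompactSupport_kernelDensity.laplacian fun x hx =>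
        (hρv x (tsupport_laplacian_subset _ hx)).continuousAt
    have hint₂ : Integrable fun x => v x * laplacian (laplacian (laplacian ψ)) x :=
      integrable_mul_of_tsupport hΔψ hψc.laplacian.laplacian.laplacian fun x hx =>
        (hψv x (tsupport_laplacian_subset _ (tsupport_laplacian_subset _
          (tsupport_laplacian_subset _ hx)))).continuousAt
    have hint₃ : Integrable fun x => laplacian (laplacian (laplacian v)) x * ψ x :=
      integrable_mul_of_tsupport hψ.continuous hψc fun x hx =>
        (contDiffAt_laplacian (k := 0) (contDiffAt_laplacian (k := 2)
          (contDiffAt_laplacian (k := 4) (by exact_mod_cast hψv x hx)))).continuousAt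
    have hint₄ : Integrable fun x => v x * laplacian (laplacian (laplacian ψ)) x -
        laplacian (laplacian (laplacian v)) x * ψ x := hint₂.sub hint₃
    have hle := integral_mono hint₁ (hint₄.add hierr) hpt
    have hsum : ∫ x, (v x * laplacian (laplacian (laplacian ψ)) x -
        laplacian (laplacian (laplacian v)) x * ψ x + err x) = ∫ x, err x := by
      rw [integral_add hint₄ hierr, integral_sub hint₂ hint₃,
        integral_laplacian_laplacian_laplacian_mul hψv hψ hψc, sub_self, zero_add]
    have herrint : ∫ x, err x = (3 * ε) ^ n * ω * e₁ + (2 * ε⁻¹) ^ n * ω * e₂ := by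
      rw [integral_add hi₁ hi₂, integral_indicator_const _ Metric.isOpen_ball.measurableSet,
        integral_indicator_const _ Metric.isOpen_ball.measurableSet,
        measureReal_ball n z (r := 3 * ε) (by positivity),
        measureReal_ball n 0 (r := 2 * ε⁻¹) (by positivity)]
      rfl
    have hε6 : (ε ^ 6) ^ q = ε ^ (((n : ℝ) + 6) / 2) := by
      rw [← Real.rpow_natCast, ← Real.rpow_mul hε.le]
      congr 1
      rw [hq]; push_cast; ring
    have h₁ : (3 * ε) ^ n * ω * e₁ =
        γ₀ * K * C ^ q * 3 ^ n * ω * ε ^ (((n : ℝ) - 6) / 2) := by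
      have h : ε ^ (((n : ℝ) - 6) / 2) = ε ^ n * (ε ^ (((n : ℝ) + 6) / 2))⁻¹ := by
        rw [← Real.rpow_natCast, ← Real.rpow_neg hε.le, ← Real.rpow_add hε]
        congr 1; ring
      rw [h, he₁, Real.mul_rpow hC (by positivity), inv_pow, Real.inv_rpow (by positivity), hε6,
        mul_pow]
      ring
    have h₂ : (2 * ε⁻¹) ^ n * ω * e₂ = K * C ^ q * ω * 16 * ε ^ (((n : ℝ) - 2) / 2) := by
      have h : (2 * ε⁻¹) ^ n * γ = 16 * ε⁻¹ ^ 4 := by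
        have : (2 * ε⁻¹) ^ n * γ = (2 * ε⁻¹) ^ 4 := by
          rw [hγ, ← Real.rpow_natCast _ 2, ← Real.rpow_mul (by positivity), ← Real.rpow_natCast,
            ← Real.rpow_add (by positivity), ← Real.rpow_natCast]
          congr 1
          rw [ha]; push_cast; ring
        rw [this]; ring
      have h' : ε ^ (((n : ℝ) - 2) / 2) = ε⁻¹ ^ 4 * ε ^ (((n : ℝ) + 6) / 2) := by
        rw [inv_pow, ← Real.rpow_natCast, ← Real.rpow_neg hε.le, ← Real.rpow_add hε]
        congr 1; push_cast; ring
      rw [h', he₂, Real.mul_rpow hC (by positivity), hε6]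
      linear_combination (ω * K * C ^ q * ε ^ (((n : ℝ) + 6) / 2)) * h
    rw [integral_laplacian_mul (fun x hx => (hρv x hx).of_le (by norm_num)) hρ2
      hasCompactSupport_kernelDensity]
    calc _ ≤ _ := hle
      _ = _ := by rw [← h₁, ← h₂, ← herrint, ← hsum]; rfl
  have hlim : Tendsto (fun ε : ℝ => γ₀ * K * C ^ q * 3 ^ n * ω * ε ^ (((n : ℝ) - 6) / 2) +
      K * C ^ q * ω * 16 * ε ^ (((n : ℝ) - 2) / 2)) (𝓝[>] 0) (𝓝 0) := by
    have h : ∀ s : ℝ, 0 < s → Tendsto (fun ε : ℝ => ε ^ s) (𝓝[>] 0) (𝓝 0) := fun s hs => by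
      have := (Real.continuousAt_rpow_const 0 s (Or.inr hs.le)).tendsto
      rw [Real.zero_rpow hs.ne'] at this
      exact this.mono_left nhdsWithin_le_nhds
    simpa using ((h (((n : ℝ) - 6) / 2) (by linarith)).const_mul
      (γ₀ * K * C ^ q * 3 ^ n * ω)).add ((h (((n : ℝ) - 2) / 2) (by linarith)).const_mul
      (K * C ^ q * ω * 16))
  refine ge_of_tendsto hlim ?_
  have hsmall : Set.Iio (min (1 / 3) (1 / (‖z‖ + 1))) ∈ 𝓝 (0 : ℝ) :=
    Iio_mem_nhds (by positivity)
  filter_upwards [self_mem_nhdsWithin, mem_nhdsWithin_of_mem_nhds hsmall] with ε hε hε'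
  have h1 : ε < 1 / 3 := lt_of_lt_of_le hε' (min_le_left _ _)
  have h2 : ε < 1 / (‖z‖ + 1) := lt_of_lt_of_le hε' (min_le_right _ _)
  exact hbound ε hε (by linarith) ((lt_div_iff₀ (by positivity)).1 h2)

end Superharmonic

section Scaling

variable {n : ℕ} {f : EuclideanSpace ℝ (Fin n) → ℝ} {x : EuclideanSpace ℝ (Fin n)}

lemma laplacian_const_mul (c : ℝ) (hf : ContDiffAt ℝ 2 f x) :
    laplacian (fun y => c * f y) x = c * laplacian f x := by
  have h : iteratedFDeriv ℝ 2 (fun y => c • f y) x = _ := iteratedFDeriv_const_smul_apply' hf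
  simp only [smul_eq_mul] at h
  simp [laplacian, h, Finset.mul_sum]

lemma laplacian_laplacian_laplacian_comp_add_smul (a : EuclideanSpace ℝ (Fin n)) (c : ℝ)
    (hf : ContDiffAt ℝ 6 f (a + c • x)) :
    laplacian (laplacian (laplacian fun y => f (a + c • y))) x =
      c ^ 6 * laplacian (laplacian (laplacian f)) (a + c • x) := by
  have hstep : ∀ {g : EuclideanSpace ℝ (Fin n) → ℝ}, ContDiffAt ℝ 2 g (a + c • x) →
      laplacian (fun y => g (a + c • y)) =ᶠ[𝓝 x] fun y => c ^ 2 * laplacian g (a + c • y) := by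
    intro g hg
    have hcont : ContinuousAt (fun y => a + c • y) x := by fun_prop
    filter_upwards [hcont.eventually (hg.eventually (by simp))] with y hy
      using laplacian_comp_add_smul a c hy
  have hmul : ∀ (k : ℝ) {g : EuclideanSpace ℝ (Fin n) → ℝ}, ContDiffAt ℝ 2 g (a + c • x) →
      laplacian (fun y => k * g (a + c • y)) =ᶠ[𝓝 x]
        fun y => k * c ^ 2 * laplacian g (a + c • y) := by
    intro k g hg
    have hc : ContDiffAt ℝ 2 (fun y => g (a + c • y)) x :=
      ContDiffAt.comp x hg (by fun_prop : ContDiffAt ℝ 2 (fun y => a + c • y) x)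
    filter_upwards [hstep hg, hc.eventually (by simp)] with y hy hy'
    rw [laplacian_const_mul k hy', hy, mul_assoc]
  have h1 : ContDiffAt ℝ (4 : ℕ) (laplacian f) (a + c • x) := contDiffAt_laplacian hf
  have h2 : ContDiffAt ℝ (2 : ℕ) (laplacian (laplacian f)) (a + c • x) := contDiffAt_laplacian h1
  have e1 := hstep (hf.of_le (by norm_num))
  have e2 := e1.laplacian.trans (hmul _ (h1.of_le (by norm_num)))
  have e3 := e2.laplacian.trans (hmul _ h2)
  rw [e3.eq_of_nhds]
  ring

lemma tendsto_integral_comp_add_smul_mul {g ρ : EuclideanSpace ℝ (Fin n) → ℝ}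
    (hg : ∀ᶠ y in 𝓝 x, ContinuousAt g y) (hρ : Continuous ρ)
    (hsupp : tsupport ρ ⊆ Metric.closedBall 0 1) :
    Tendsto (fun δ : ℝ => ∫ y, g (x + δ • y) * ρ y) (𝓝[>] 0) (𝓝 (g x * ∫ y, ρ y)) := by
  have hρc : HasCompactSupport ρ := HasCompactSupport.of_support_subset_isCompact
    (isCompact_closedBall 0 1) ((subset_tsupport _).trans hsupp)
  have hbd : ∀ᶠ y in 𝓝 x, ‖g y‖ < ‖g x‖ + 1 :=
    hg.self_of_nhds.norm.eventually (Iio_mem_nhds (lt_add_one _))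
  obtain ⟨r, hr, hball⟩ := Metric.eventually_nhds_iff.1 (hg.and hbd)
  have hnear : ∀ᶠ δ : ℝ in 𝓝[>] 0, ∀ y ∈ tsupport ρ, ContinuousAt g (x + δ • y) ∧
      ‖g (x + δ • y)‖ < ‖g x‖ + 1 := by
    filter_upwards [self_mem_nhdsWithin, mem_nhdsWithin_of_mem_nhds (Iio_mem_nhds hr)]
      with δ hδ hδr y hy
    have hδ : 0 < δ := hδ
    have hδr : δ < r := hδr
    have hy : ‖y‖ ≤ 1 := mem_closedBall_zero_iff.1 (hsupp hy)
    refine hball ?_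
    rw [dist_eq_norm, add_sub_cancel_left, norm_smul, Real.norm_of_nonneg hδ.le]
    nlinarith
  rw [← integral_const_mul]
  refine tendsto_integral_filter_of_dominated_convergence (fun y => (‖g x‖ + 1) * ‖ρ y‖) ?_ ?_
    ((hρ.integrable_of_hasCompactSupport hρc).norm.const_mul _) ?_
  · filter_upwards [hnear] with δ hδ
    refine (integrable_mul_of_tsupport hρ hρc fun y hy => ?_).aestronglyMeasurable
    exact ContinuousAt.comp (f := fun y => x + δ • y) (hδ y hy).1 (by fun_prop)
  · filter_upwards [hnear] with δ hδ
    refine Eventually.of_forall fun y => ?_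
    by_cases hy : y ∈ tsupport ρ
    · rw [norm_mul]
      exact mul_le_mul_of_nonneg_right (hδ y hy).2.le (norm_nonneg _)
    · simp [image_eq_zero_of_notMem_tsupport hy]
  · refine Eventually.of_forall fun y => Tendsto.mul_const _ ?_
    have h : Tendsto (fun δ : ℝ => x + δ • y) (𝓝[>] 0) (𝓝 x) := by
      have : Continuous fun δ : ℝ => x + δ • y := by fun_prop
      simpa using (this.tendsto 0).mono_left nhdsWithin_le_nhds
    exact hg.self_of_nhds.tendsto.comp h

end Scaling

theorem superharmonicity_of_singular_solutions
    (n : ℕ) (hn : 7 ≤ n)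
    (u : EuclideanSpace ℝ (Fin n) → ℝ)
    (hpos : ∀ x : EuclideanSpace ℝ (Fin n), x ≠ 0 → 0 < u x)
    (hreg : ContDiffOn ℝ 6 u {x : EuclideanSpace ℝ (Fin n) | x ≠ 0})
    (hpde : ∀ x : EuclideanSpace ℝ (Fin n), x ≠ 0 →
      -(laplacian (laplacian (laplacian u)) x) = cN n * u x ^ (((n : ℝ) + 6) / ((n : ℝ) - 6)))
    (hsing : ∀ M : ℝ, ∀ ε : ℝ, 0 < ε → ∃ x : EuclideanSpace ℝ (Fin n),
      x ≠ 0 ∧ ‖x‖ < ε ∧ M < u x) :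
    ∀ x : EuclideanSpace ℝ (Fin n), x ≠ 0 → 0 ≤ -(laplacian u x) := by
  intro x hx
  have hreg' : ∀ y, y ≠ 0 → ContDiffAt ℝ 6 u y := fun y hy =>
    hreg.contDiffAt (isOpen_ne.mem_nhds hy)
  have hcN : 0 < cN n := by
    have hn' : (7 : ℝ) ≤ n := by exact_mod_cast hn
    have h1 : 0 < (n : ℝ) - 6 := by linarith
    have h2 : 0 < ((n : ℝ) ^ 2 - 4) * ((n : ℝ) ^ 2 - 16) := mul_pos (by nlinarith) (by nlinarith)
    have h3 : 0 < (n : ℝ) ^ 4 - 20 * (n : ℝ) ^ 2 + 64 := by linarith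
    rw [cN]
    positivity
  have hxn : 0 < ‖x‖ := norm_pos_iff.2 hx
  have hneg : ∀ᶠ δ : ℝ in 𝓝[>] 0, ∫ y, laplacian u (x + δ • y) * kernelDensity n y ≤ 0 := by
    filter_upwards [self_mem_nhdsWithin, mem_nhdsWithin_of_mem_nhds
      (Iio_mem_nhds (show 0 < ‖x‖ / 3 by positivity))] with δ hδ hδx
    have hδ : 0 < δ := hδ
    have hδx : δ < ‖x‖ / 3 := hδx
    have hne : ∀ y, y ≠ -(δ⁻¹ • x) → x + δ • y ≠ 0 := fun y hy h => hy <| by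
      rw [← smul_neg, neg_eq_of_add_eq_zero_right h, inv_smul_smul₀ hδ.ne']
    have hz : 3 ≤ ‖-(δ⁻¹ • x)‖ := by
      rw [norm_neg, norm_smul, norm_inv, Real.norm_of_nonneg hδ.le, ← div_eq_inv_mul,
        le_div_iff₀ hδ]
      linarith
    have hcore := integral_laplacian_mul_kernelDensity_nonpos hn
      (mul_pos (pow_pos hδ 6) hcN) hz (v := fun y => u (x + δ • y))
      (fun y hy => hpos _ (hne y hy))
      (fun y hy => ContDiffAt.comp y (hreg' _ (hne y hy))
        (by fun_prop : ContDiffAt ℝ 6 (fun y => x + δ • y) y))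
      (fun y hy => by
        rw [laplacian_laplacian_laplacian_comp_add_smul x δ (hreg' _ (hne y hy)), ← mul_neg,
          hpde _ (hne y hy), mul_assoc])
    have hscale : ∀ y, laplacian (fun y => u (x + δ • y)) y * kernelDensity n y =
        δ ^ 2 * (laplacian u (x + δ • y) * kernelDensity n y) := fun y => by
      rcases eq_or_ne y (-(δ⁻¹ • x)) with rfl | hy
      · simp [kernelDensity_eq_zero (show 1 < ‖-(δ⁻¹ • x)‖ by linarith)]
      · rw [laplacian_comp_add_smul x δ ((hreg' _ (hne y hy)).of_le (by norm_num)), mul_assoc]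
    simp_rw [hscale] at hcore
    rw [integral_const_mul] at hcore
    exact nonpos_of_mul_nonpos_right hcore (by positivity)
  have hcont : ∀ᶠ y in 𝓝 x, ContinuousAt (laplacian u) y := by
    filter_upwards [isOpen_ne.mem_nhds hx] with y hy
    exact (contDiffAt_laplacian (k := 4) (by exact_mod_cast hreg' y hy)).continuousAt
  have hle := le_of_tendsto (tendsto_integral_comp_add_smul_mul hcont
    contDiff_kernelDensity.continuous tsupport_kernelDensity_subset) hneg
  have hint : 0 < ∫ y, kernelDensity n y :=
    integral_radialLaplacian_radialLaplacian_cutPower_pos (by omega)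
  exact neg_nonneg.2 (nonpos_of_mul_nonpos_left hle hint)
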